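/- In the pizza game, Alice has a strategy guaranteeing her at least 4/9 of the total size of any pizza, and the constant 4/9 is optimal. -/

import Mathlib

/-!
Pizza game model.  Pieces are indexed by `ZMod n`.  A play is determined by
Alice's starting piece `p` and a sequence of direction choices
`d : ℕ → Bool`: the choice `d t` determines the piece eaten at move `t+1`
(`true` = clockwise end of the eaten interval, `false` = counterclockwise).
Moves are numbered `0, …, n-1`; Alice moves at even indices, Bob at odd ones,
so the choice `d t` is made by Bob when `t` is even and by Alice when `t` is odd.
A strategy is a function from the list of previous direction choices to a choice.
-/

/-- The history of direction choices after `t` choices, when Alice plays `σ`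
and Bob plays `τ`. -/
def hist (σ τ : List Bool → Bool) : ℕ → List Bool
  | 0 => []
  | t + 1 => hist σ τ t ++ [if Even t then τ (hist σ τ t) else σ (hist σ τ t)]

/-- The direction chosen at step `t` (determining the piece eaten at move `t+1`,
which belongs to Alice iff `t` is odd): Bob chooses it if `t` is even,
Alice if `t` is odd. -/
def choice (σ τ : List Bool → Bool) (t : ℕ) : Bool :=
  if Even t then τ (hist σ τ t) else σ (hist σ τ t)

/-- The piece eaten at move `t`, given starting piece `p` and direction
choices `d`. -/
def piece (n : ℕ) (p : ZMod n) (d : ℕ → Bool) : ℕ → ZMod n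
  | 0 => p
  | t + 1 =>
      if d t then
        p + ((((Finset.range (t + 1)).filter fun i => d i = true).card : ℕ) : ZMod n)
      else
        p - ((((Finset.range (t + 1)).filter fun i => d i = false).card : ℕ) : ZMod n)

/-- Alice's outcome: total size of the pieces eaten at even-numbered moves. -/
noncomputable def aliceOutcome (n : ℕ) [NeZero n] (s : ZMod n → ℝ) (p : ZMod n)
    (σ τ : List Bool → Bool) : ℝ :=
  ∑ t ∈ Finset.range n, if Even t then s (piece n p (choice σ τ) t) else 0

/-- Bob's outcome: total size of the pieces eaten at odd-numbered moves. -/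
noncomputable def bobOutcome (n : ℕ) [NeZero n] (s : ZMod n → ℝ) (p : ZMod n)
    (σ τ : List Bool → Bool) : ℝ :=
  ∑ t ∈ Finset.range n, if Even t then 0 else s (piece n p (choice σ τ) t)

/-- The follow-Bob strategy: Alice always repeats Bob's previous direction
choice, i.e. she picks the piece just revealed by Bob. -/
def followBob : List Bool → Bool := fun L => L.getLastD true

/-- The larger of Alice's two options when the remaining pieces are `a, …, a + r`
and `B` is the value of the position she leaves, as a function of its first piece. -/
noncomputable def alicePick (φ : ℤ → ℝ) (r : ℕ) (B : ℤ → ℝ) (a : ℤ) : ℝ :=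
  max (φ a + B (a + 1)) (φ (a + r) + B a)

/-- Alice's optimal outcome from the remaining pieces `a, …, a + r - 1` with Bob to move. -/
noncomputable def bobVal (φ : ℤ → ℝ) : ℕ → ℤ → ℝ
  | 0, _ => 0
  | 1, _ => 0
  | r + 2, a => min (alicePick φ r (bobVal φ r) (a + 1)) (alicePick φ r (bobVal φ r) a)

/-- The number of clockwise choices among the first `t`. -/
def clockwiseCount (d : ℕ → Bool) (t : ℕ) : ℕ :=
  ((Finset.range t).filter fun i => d i = true).card

lemma clockwiseCount_succ (d : ℕ → Bool) (t : ℕ) :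
    clockwiseCount d (t + 1) = clockwiseCount d t + if d t then 1 else 0 := by
  unfold clockwiseCount
  rw [Finset.range_add_one, Finset.filter_insert]
  split_ifs with h
  · rw [Finset.card_insert_of_notMem (by simp)]
  · rfl

lemma hist_length (σ τ : List Bool → Bool) (t : ℕ) : (hist σ τ t).length = t := by
  induction t with
  | zero => rfl
  | succ t ih => simp [hist, ih]

lemma hist_count (σ τ : List Bool → Bool) (t : ℕ) :
    (hist σ τ t).count true = clockwiseCount (choice σ τ) t := by
  induction t with
  | zero => rfl
  | succ t ih =>
    rw [clockwiseCount_succ, ← ih]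
    change (hist σ τ t ++ [choice σ τ t]).count true = _
    cases h : choice σ τ t <;> simp

lemma piece_succ_true (n : ℕ) (p : ℤ) (d : ℕ → Bool) (t : ℕ) (h : d t = true) :
    piece n (p : ZMod n) d (t + 1) = ((p + 1 + clockwiseCount d t : ℤ) : ZMod n) := by
  have h1 := clockwiseCount_succ d t
  rw [if_pos h] at h1
  unfold clockwiseCount at h1 ⊢
  simp only [piece, h, if_true, h1]
  push_cast
  ring

lemma piece_succ_false (n : ℕ) (p : ℤ) (d : ℕ → Bool) (t : ℕ) (h : d t = false) :
    piece n (p : ZMod n) d (t + 1) = ((p + clockwiseCount d t + n - 1 - t : ℤ) : ZMod n) := by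
  have h1 := clockwiseCount_succ d t
  have h2 := Finset.card_filter_add_card_filter_not (s := Finset.range (t + 1)) (fun i => d i = true)
  simp only [Bool.not_eq_true, Finset.card_range] at h2
  simp only [h, Bool.false_eq_true, if_false, add_zero] at h1
  unfold clockwiseCount at h1 ⊢
  rw [h1] at h2
  have h3 := congrArg (Nat.cast (R := ZMod n)) h2
  push_cast at h3
  simp only [piece, h, Bool.false_eq_true, if_false]
  push_cast
  rw [ZMod.natCast_self]
  linear_combination -h3

/-- Alice's pick at an odd step realises one of the two options in `alicePick`. -/
lemma size_piece_add {n : ℕ} (s : ZMod n → ℝ) (p : ℤ) (d : ℕ → Bool) (t r : ℕ)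
    (hr : n = t + r + 3) (B : ℤ → ℝ) :
    s (piece n (p : ZMod n) d (t + 2)) + B (p + 1 + clockwiseCount d (t + 2)) =
      if d (t + 1) then
        s ((p + 1 + clockwiseCount d (t + 1) : ℤ) : ZMod n) +
          B (p + 1 + clockwiseCount d (t + 1) + 1)
      else
        s ((p + 1 + clockwiseCount d (t + 1) + r : ℤ) : ZMod n) +
          B (p + 1 + clockwiseCount d (t + 1)) := by
  rw [clockwiseCount_succ d (t + 1)]
  split_ifs with h
  · rw [piece_succ_true _ _ _ _ h]
    push_cast
    ring_nf
  · rw [piece_succ_false _ _ _ _ (by simpa using h)]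
    have : (p + clockwiseCount d (t + 1) + n - 1 - (t + 1 : ℕ) : ℤ) =
        p + 1 + clockwiseCount d (t + 1) + r := by
      rw [hr]; push_cast; ring
    rw [this]
    simp

lemma bobVal_eq_zero (φ : ℤ → ℝ) (r : ℕ) (hr : r < 2) (a : ℤ) : bobVal φ r a = 0 := by
  interval_cases r <;> rfl

/-- If along a play the value never decreases in a round, Alice gets at least the initial value. -/
lemma le_aliceSum {n : ℕ} (hn : 0 < n) (s : ZMod n → ℝ) (p : ℤ) (d : ℕ → Bool)
    (B : ℕ → ℤ → ℝ) (hB : ∀ r < 2, ∀ a, B r a = 0)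
    (hstep : ∀ t r, Even t → n = t + r + 3 →
      B (r + 2) (p + 1 + clockwiseCount d t) ≤
        s (piece n (p : ZMod n) d (t + 2)) + B r (p + 1 + clockwiseCount d (t + 2))) :
    s (p : ZMod n) + B (n - 1) (p + 1) ≤
      ∑ t ∈ Finset.range n, if Even t then s (piece n (p : ZMod n) d t) else 0 := by
  have key : ∀ k, 2 * k < n → s (p : ZMod n) + B (n - 1) (p + 1) ≤
      (∑ t ∈ Finset.range (2 * k + 1), if Even t then s (piece n (p : ZMod n) d t) else 0) +
        B (n - 1 - 2 * k) (p + 1 + clockwiseCount d (2 * k)) := by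
    intro k
    induction k with
    | zero => intro _; simp [piece, clockwiseCount]
    | succ k ih =>
      intro hk
      refine (ih (by lia)).trans ?_
      obtain ⟨r, hr⟩ : ∃ r, n = 2 * k + r + 3 := ⟨n - 2 * k - 3, by lia⟩
      have h1 := hstep (2 * k) r (by simp) hr
      rw [show n - 1 - 2 * k = r + 2 by lia, show n - 1 - 2 * (k + 1) = r by lia,
        show 2 * (k + 1) + 1 = 2 * k + 1 + 1 + 1 by ring,
        Finset.sum_range_succ _ (2 * k + 1 + 1), Finset.sum_range_succ _ (2 * k + 1),
        if_neg (by simp), if_pos (by simp [parity_simps])]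
      rw [show 2 * (k + 1) = 2 * k + 2 by ring]
      linarith
  have h := key ((n - 1) / 2) (by lia)
  rw [hB (n - 1 - 2 * ((n - 1) / 2)) (by lia), add_zero] at h
  refine h.trans_eq ?_
  rcases Nat.even_or_odd n with he | ho
  · obtain ⟨m, rfl⟩ : ∃ m, n = 2 * m + 2 := ⟨(n - 2) / 2, by obtain ⟨x, hx⟩ := he; lia⟩
    rw [show (2 * m + 2 - 1) / 2 = m by lia, Finset.sum_range_succ _ (2 * m + 1),
      if_neg (by simp), add_zero]
  · obtain ⟨m, rfl⟩ := ho
    rw [show (2 * m + 1 - 1) / 2 = m by lia]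

/-- Alice can guarantee the value of the game. -/
lemma exists_strategy_alice {n : ℕ} [NeZero n] (s : ZMod n → ℝ) (p : ℤ) :
    ∃ σ : List Bool → Bool, ∀ τ : List Bool → Bool,
      s (p : ZMod n) + bobVal (fun z : ℤ => s z) (n - 1) (p + 1) ≤
        aliceOutcome n s (p : ZMod n) σ τ := by
  classical
  set φ : ℤ → ℝ := fun z : ℤ => s z with hφ
  refine ⟨fun L => decide (φ (p + 1 + L.count true + (n - 2 - L.length : ℕ)) +
      bobVal φ (n - 2 - L.length) (p + 1 + L.count true) ≤
      φ (p + 1 + L.count true) + bobVal φ (n - 2 - L.length) (p + 1 + L.count true + 1)), ?_⟩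
  intro τ
  set σ := _
  change _ ≤ aliceOutcome n s p σ τ
  refine le_aliceSum (NeZero.pos n) s p (choice σ τ) (bobVal φ) (bobVal_eq_zero φ) ?_
  intro t r ht hr
  set d := choice σ τ with hd
  rw [size_piece_add s p d t r hr]
  have hbob : bobVal φ (r + 2) (p + 1 + clockwiseCount d t) ≤
      alicePick φ r (bobVal φ r) (p + 1 + clockwiseCount d (t + 1)) := by
    rw [clockwiseCount_succ]
    split_ifs
    · push_cast
      rw [← add_assoc]
      exact min_le_left _ _
    · rw [add_zero]
      exact min_le_right _ _
  refine hbob.trans ?_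
  have hodd : ¬ Even (t + 1) := by simpa [parity_simps] using ht
  have hlen : n - 2 - (t + 1) = r := by lia
  have hc : d (t + 1) = σ (hist σ τ (t + 1)) := by rw [hd, choice, if_neg hodd]
  have hσ : σ (hist σ τ (t + 1)) = decide (φ (p + 1 + clockwiseCount d (t + 1) + r) +
      bobVal φ r (p + 1 + clockwiseCount d (t + 1)) ≤
      φ (p + 1 + clockwiseCount d (t + 1)) + bobVal φ r (p + 1 + clockwiseCount d (t + 1) + 1)) := by
    have h1 := hist_length σ τ (t + 1)
    have h2 := hist_count σ τ (t + 1)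
    rw [← hd] at h2
    have hL : n - 2 - (hist σ τ (t + 1)).length = r := by rw [h1, hlen]
    rw [← h2, ← hL]
  rw [hc, hσ]
  unfold alicePick
  split_ifs with h
  · rw [decide_eq_true_eq] at h
    exact max_le le_rfl h
  · rw [decide_eq_true_eq, not_le] at h
    exact max_le h.le le_rfl

/-- Bob can hold Alice to the value of the game. -/
lemma exists_strategy_bob {n : ℕ} [NeZero n] (s : ZMod n → ℝ) (p : ℤ) :
    ∃ τ : List Bool → Bool, ∀ σ : List Bool → Bool,
      aliceOutcome n s (p : ZMod n) σ τ ≤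
        s (p : ZMod n) + bobVal (fun z : ℤ => s z) (n - 1) (p + 1) := by
  classical
  set φ : ℤ → ℝ := fun z : ℤ => s z with hφ
  refine ⟨fun L => decide (alicePick φ (n - 3 - L.length) (bobVal φ (n - 3 - L.length))
      (p + 1 + L.count true + 1) ≤ alicePick φ (n - 3 - L.length) (bobVal φ (n - 3 - L.length))
      (p + 1 + L.count true)), ?_⟩
  intro σ
  set τ := _
  change aliceOutcome n s p σ τ ≤ _
  have key := le_aliceSum (NeZero.pos n) (-s) p (choice σ τ) (fun r a => - bobVal φ r a)
    (fun r hr a => by rw [bobVal_eq_zero φ r hr, neg_zero]) ?_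
  · have h2 : (∑ t ∈ Finset.range n, if Even t then (-s) (piece n (p : ZMod n) (choice σ τ) t)
        else 0) = - aliceOutcome n s p σ τ := by
      rw [aliceOutcome, ← Finset.sum_neg_distrib]
      refine Finset.sum_congr rfl fun t _ => ?_
      split_ifs <;> simp
    rw [h2] at key
    simp only [Pi.neg_apply] at key
    linarith
  intro t r ht hr
  set d := choice σ τ with hd
  have h0 := size_piece_add s p d t r hr (bobVal φ r)
  have hlen : n - 3 - t = r := by lia
  have hc : d t = τ (hist σ τ t) := by rw [hd, choice, if_pos ht]
  have hτ : τ (hist σ τ t) = decide (alicePick φ r (bobVal φ r)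
      (p + 1 + clockwiseCount d t + 1) ≤ alicePick φ r (bobVal φ r)
      (p + 1 + clockwiseCount d t)) := by
    have h1 := hist_length σ τ t
    have h2 := hist_count σ τ t
    rw [← hd] at h2
    have hL : n - 3 - (hist σ τ t).length = r := by rw [h1, hlen]
    rw [← h2, ← hL]
  have hbob : alicePick φ r (bobVal φ r) (p + 1 + clockwiseCount d (t + 1)) ≤
      bobVal φ (r + 2) (p + 1 + clockwiseCount d t) := by
    rw [clockwiseCount_succ, hc, hτ]
    split_ifs with h
    · rw [decide_eq_true_eq] at h
      push_cast
      rw [← add_assoc]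
      exact le_min le_rfl h
    · rw [decide_eq_true_eq, not_le] at h
      rw [add_zero]
      exact le_min h.le le_rfl
  have hpick : s (piece n (p : ZMod n) d (t + 2)) + bobVal φ r (p + 1 + clockwiseCount d (t + 2)) ≤
      alicePick φ r (bobVal φ r) (p + 1 + clockwiseCount d (t + 1)) := by
    rw [h0]
    split_ifs
    · exact le_max_left _ _
    · exact le_max_right _ _
  simp only [Pi.neg_apply]
  linarith

/-- `bobVal` for natural-number sizes, in computable form. -/
def bobValNat (g : ℕ → ℕ) : ℕ → ℕ → ℕ
  | 0, _ => 0
  | 1, _ => 0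
  | r + 2, a =>
    let x := bobValNat g r (a + 1)
    min (max (g (a + 1) + bobValNat g r (a + 2)) (g (a + 1 + r) + x))
      (max (g a + x) (g (a + r) + bobValNat g r a))

lemma bobVal_natCast (g : ℕ → ℕ) (φ : ℤ → ℝ) (h : ∀ a : ℕ, φ a = g a) :
    ∀ (r a : ℕ), bobVal φ r a = bobValNat g r a
  | 0, _ => by simp [bobVal, bobValNat]
  | 1, _ => by simp [bobVal, bobValNat]
  | r + 2, a => by
    have h1 := bobVal_natCast g φ h r (a + 1)
    have h2 := bobVal_natCast g φ h r (a + 2)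
    have h3 := bobVal_natCast g φ h r a
    have g1 := h (a + 1)
    have g2 := h (a + 1 + r)
    have g3 := h (a + r)
    push_cast at h1 h2 g1 g2 g3
    simp only [bobVal, bobValNat, alicePick, add_assoc, one_add_one_eq_two, Nat.cast_min,
      Nat.cast_max, Nat.cast_add] at *
    rw [h1, h2, h3, g1, g2, g3, h]

/-- A pizza with 15 pieces of total size 9. -/
def extremalPizza (a : ℕ) : ℕ :=
  [0, 2, 0, 0, 2, 0, 2, 0, 0, 1, 0, 1, 0, 0, 1].getD (a % 15) 0

lemma extremalPizza_value :
    ∀ p < 15, extremalPizza p + bobValNat extremalPizza 14 (p + 1) ≤ 4 := by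
  decide +kernel

lemma exists_pizza_le_four_ninths :
    ∃ (n : ℕ) (s : ZMod (n + 1) → ℝ), (∀ i, 0 ≤ s i) ∧
      ∃ τ : ZMod (n + 1) → List Bool → Bool, ∀ (p : ZMod (n + 1)) (σ : List Bool → Bool),
        aliceOutcome (n + 1) s p σ (τ p) ≤ (4 / 9) * ∑ i, s i := by
  refine ⟨14, fun i => extremalPizza i.val, fun i => Nat.cast_nonneg _, ?_⟩
  set s : ZMod 15 → ℝ := fun i => extremalPizza i.val with hs
  have hsum : ∑ i, s i = 9 := by
    have : ∑ i : ZMod 15, extremalPizza i.val = 9 := by decide +kernel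
    rw [hs, ← Nat.cast_sum, this]
    norm_num
  choose τ hτ using fun p : ZMod 15 => exists_strategy_bob s (p.val : ℤ)
  refine ⟨τ, fun p σ => ?_⟩
  have hφ : ∀ a : ℕ, (fun z : ℤ => s z) a = extremalPizza a := by
    intro a
    simp [hs, ZMod.val_natCast, extremalPizza]
  have h1 := hτ p σ
  have h2 := bobVal_natCast extremalPizza (fun z : ℤ => s z) hφ 14 (p.val + 1)
  have h3 := extremalPizza_value p.val (ZMod.val_lt p)
  have h4 : (extremalPizza p.val : ℝ) + bobValNat extremalPizza 14 (p.val + 1) ≤ 4 := by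
    exact_mod_cast h3
  have hcast : ((p.val : ℤ) : ZMod 15) = p := by
    rw [Int.cast_natCast, ZMod.natCast_zmod_val]
  push_cast at h2
  rw [hcast, show (15 - 1 : ℕ) = 14 from rfl, h2] at h1
  change aliceOutcome 15 s p σ (τ p) ≤ (4 / 9) * ∑ i, s i
  rw [hsum]
  change _ ≤ (extremalPizza p.val : ℝ) + _ at h1
  linarith

/-- The sum of `k` pieces of `φ` at distance two, beginning with piece `a`. -/
noncomputable def altSum (φ : ℤ → ℝ) (a : ℤ) (k : ℕ) : ℝ :=
  ∑ i ∈ Finset.range k, φ (a + 2 * i)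

lemma altSum_zero (φ : ℤ → ℝ) (a : ℤ) : altSum φ a 0 = 0 := by simp [altSum]

lemma altSum_succ (φ : ℤ → ℝ) (a : ℤ) (k : ℕ) :
    altSum φ a (k + 1) = altSum φ a k + φ (a + 2 * k) := by
  simp [altSum, Finset.sum_range_succ]

lemma altSum_add (φ : ℤ → ℝ) (a : ℤ) (k l : ℕ) :
    altSum φ a (k + l) = altSum φ a k + altSum φ (a + 2 * k) l := by
  simp [altSum, Finset.sum_range_add, mul_add, add_assoc]

lemma altSum_succ' (φ : ℤ → ℝ) (a : ℤ) (k : ℕ) :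
    altSum φ a (k + 1) = φ a + altSum φ (a + 2) k := by
  rw [add_comm k 1, altSum_add]
  simp [altSum]

lemma altSum_nonneg {φ : ℤ → ℝ} (hφ : ∀ z, 0 ≤ φ z) (a : ℤ) (k : ℕ) : 0 ≤ altSum φ a k :=
  Finset.sum_nonneg fun _ _ => hφ _

lemma altSum_periodic {φ : ℤ → ℝ} {n : ℤ} (hper : ∀ z, φ (z + n) = φ z) (a : ℤ) (k : ℕ) :
    altSum φ (a + n) k = altSum φ a k := by
  refine Finset.sum_congr rfl fun i _ => ?_
  rw [add_right_comm, hper]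

lemma altSum_add_two {φ : ℤ → ℝ} {m : ℕ} (hper : ∀ z, φ (z + (2 * m + 1)) = φ z) (z : ℤ) :
    altSum φ (z + 2) (m + 1) = altSum φ z (m + 1) + φ (z + 1) - φ z := by
  have h1 := altSum_succ' φ z (m + 1)
  have h2 := altSum_succ φ z (m + 1)
  have h3 := hper (z + 1)
  rw [show z + 1 + (2 * (m : ℤ) + 1) = z + 2 * ((m + 1 : ℕ) : ℤ) by push_cast; ring] at h3
  linarith

lemma bobVal_two_mul_succ (φ : ℤ → ℝ) (k : ℕ) (a : ℤ) :
    bobVal φ (2 * (k + 1)) a =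
      min (max (φ (a + 1) + bobVal φ (2 * k) (a + 2)) (φ (a + 2 * k + 1) + bobVal φ (2 * k) (a + 1)))
        (max (φ a + bobVal φ (2 * k) (a + 1)) (φ (a + 2 * k) + bobVal φ (2 * k) a)) := by
  change min (alicePick φ (2 * k) (bobVal φ (2 * k)) (a + 1))
    (alicePick φ (2 * k) (bobVal φ (2 * k)) a) = _
  simp only [alicePick]
  push_cast
  rw [add_assoc a 1 1, add_right_comm a 1, one_add_one_eq_two]

/-- Lower bound for Alice's outcome when she always takes the piece just revealed by Bob. -/
lemma le_bobVal_of_followBob {φ : ℤ → ℝ} {m : ℕ} (hper : ∀ z, φ (z + (2 * m + 1)) = φ z)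
    (μ : ℝ) (k : ℕ) (a : ℤ) (h : ∀ j : ℕ, j ≤ k → μ ≤ altSum φ (a + 2 * j) (m + 1)) :
    μ + altSum φ a k - altSum φ a (m + 1) ≤ bobVal φ (2 * k) a := by
  induction k generalizing a with
  | zero =>
    have := h 0 le_rfl
    simp only [Nat.cast_zero, mul_zero, add_zero] at this
    simp only [altSum_zero, bobVal]
    linarith
  | succ k ih =>
    rw [bobVal_two_mul_succ]
    refine le_min (le_max_of_le_left ?_) (le_max_of_le_right ?_)
    · have h1 := ih (a + 2) fun j hj => by
        have := h (j + 1) (by lia)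
        rwa [show a + 2 * ((j + 1 : ℕ) : ℤ) = a + 2 + 2 * j by push_cast; ring] at this
      have h2 := altSum_add_two hper a
      have h3 := altSum_succ' φ a k
      linarith
    · have h1 := ih a fun j hj => h j (by lia)
      have h3 := altSum_succ φ a k
      linarith

section Interval

variable {φ : ℤ → ℝ} {α : ℤ} {u v w : ℕ} {μ : ℝ}

/-- Bob has just finished the interval `[α, α + 2u]` at its upper end. -/
lemma le_jump_of_upper_end
    (hper : ∀ z, φ (z + (2 * (u + v + w + 1 : ℕ) + 1)) = φ z)
    (hμ : ∀ i : ℕ, i ≤ 2 * u + v + w + 1 → μ ≤ altSum φ (α + 1 + 2 * i) (u + v + w + 1 + 1))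
    (y : ℕ) (hy : y ≤ u) :
    μ - (altSum φ α (u + 1) - altSum φ α (y + 1)) ≤
      φ (α + 2 * y) + bobVal φ (2 * (v + w + 1 + y)) (α + 2 * u + 1) := by
  have h1 := le_bobVal_of_followBob hper μ (v + w + 1 + y) (α + 2 * u + 1) fun j hj => by
    have := hμ (u + j) (by lia)
    rwa [show α + 1 + 2 * ((u + j : ℕ) : ℤ) = α + 2 * u + 1 + 2 * j by push_cast; ring] at this
  obtain ⟨x, rfl⟩ := Nat.exists_eq_add_of_le hy
  have h2 := altSum_add φ (α + 2 * (y + x : ℕ) + 1) (v + w + 1 + y) (x + 1)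
  have h3 := altSum_periodic hper (α + 2 * y) (x + 1)
  have h4 := altSum_add φ α y (x + 1)
  have h5 := altSum_succ φ α y
  rw [show α + 2 * (y + x : ℕ) + 1 + 2 * (v + w + 1 + y : ℕ) =
    α + 2 * y + (2 * (y + x + v + w + 1 : ℕ) + 1) by push_cast; ring, h3] at h2
  rw [show y + x + v + w + 1 + 1 = v + w + 1 + y + (x + 1) by ring] at h1
  rw [show y + (x + 1) = y + x + 1 by ring] at h4
  linarith

/-- Bob has just finished the interval `[α, α + 2u]` at its lower end. -/
lemma le_jump_of_lower_end
    (hper : ∀ z, φ (z + (2 * (u + v + w + 1 : ℕ) + 1)) = φ z)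
    (hμ : ∀ i : ℕ, i ≤ 2 * u + v + w + 1 → μ ≤ altSum φ (α + 1 + 2 * i) (u + v + w + 1 + 1))
    (x K : ℕ) (hK : K + x = u + v + w + 1) :
    μ - altSum φ α x ≤ φ (α + 2 * x) + bobVal φ (2 * K) (α + 2 * x + 1) := by
  have h1 := le_bobVal_of_followBob hper μ K (α + 2 * x + 1) fun j hj => by
    have := hμ (x + j) (by lia)
    rwa [show α + 1 + 2 * ((x + j : ℕ) : ℤ) = α + 2 * x + 1 + 2 * j by push_cast; ring] at this
  have h2 := altSum_add φ (α + 2 * x + 1) K (x + 1)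
  have h3 := altSum_periodic hper α (x + 1)
  have h4 := altSum_succ φ α x
  rw [show α + 2 * (x : ℤ) + 1 + 2 * K = α + (2 * (u + v + w + 1 : ℕ) + 1) by
    rw [← hK]; push_cast; ring, h3, ← add_assoc, hK] at h2
  linarith

/-- What Alice gains when Bob completes the interval `[α, α + 2u]` at its upper end after the
pieces from `α + 2k - 1` upwards have been eaten. -/
noncomputable def upperGain (φ : ℤ → ℝ) (α : ℤ) (u k : ℕ) : ℝ :=
  altSum φ (α - 1) (u + 1) - altSum φ (α - 1) k + altSum φ α k

/-- What Alice gains when Bob completes the interval `[α, α + 2u]` at its lower end after the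
pieces from `α + 2k - 1` downwards have been eaten. -/
noncomputable def lowerGain (φ : ℤ → ℝ) (α : ℤ) (u k : ℕ) : ℝ :=
  altSum φ (α - 1) (k + 1) - altSum φ (α - 1) 1 + altSum φ α (u + 1) - altSum φ α k

/-- Position with Bob to move where exactly `[α + 2k - 1, α + 2r - 1]` has been eaten: Alice
follows Bob until he finishes the interval `[α, α + 2u]` at one end, and then jumps. -/
lemma le_bobVal_of_minority
    (hper : ∀ z, φ (z + (2 * (u + v + w + 1 : ℕ) + 1)) = φ z)
    (hμ : ∀ i : ℕ, i ≤ 2 * u + v + w + 1 → μ ≤ altSum φ (α + 1 + 2 * i) (u + v + w + 1 + 1))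
    (t : ℝ) (M k r : ℕ) (hk : 1 ≤ k) (hkr : k ≤ r) (hr : r ≤ u) (hM : M + r = u + v + w + 1 + k)
    (hg : ∀ i, 1 ≤ i → i ≤ k → t ≤ upperGain φ α u i)
    (hh : ∀ i, r ≤ i → i ≤ u → t ≤ lowerGain φ α u i) :
    μ - altSum φ α (u + 1) + t - (altSum φ (α - 1) (r + 1) - altSum φ (α - 1) k) ≤
      bobVal φ (2 * M) (α + 2 * r) := by
  induction M generalizing k r with
  | zero => lia
  | succ M ih =>
    rw [bobVal_two_mul_succ]
    refine le_min ?_ ?_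
    · rcases hr.eq_or_lt with rfl | hlt
      · refine le_max_of_le_right ?_
        obtain ⟨y, rfl⟩ : ∃ y, k = y + 1 := ⟨k - 1, by lia⟩
        obtain rfl : M = v + w + 1 + y := by lia
        have h1 := le_jump_of_upper_end hper hμ y (by lia)
        have h2 := hg (y + 1) (by lia) le_rfl
        rw [upperGain] at h2
        rw [show α + 2 * (r : ℤ) + 2 * (v + w + 1 + y : ℕ) + 1 =
          α + 2 * y + (2 * (r + v + w + 1 : ℕ) + 1) by push_cast; ring, hper]
        linarith
      · refine le_max_of_le_left ?_
        have h1 := ih k (r + 1) hk (by lia) hlt (by lia) hg fun i hi => hh i (by lia)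
        have h2 := altSum_succ φ (α - 1) (r + 1)
        rw [show α - 1 + 2 * (r + 1 : ℕ) = α + 2 * r + 1 by push_cast; ring] at h2
        rw [show α + 2 * (r + 1 : ℕ) = α + 2 * r + 2 by push_cast; ring] at h1
        linarith
    · rcases hk.eq_or_lt with rfl | hlt
      · refine le_max_of_le_left ?_
        have h1 := le_jump_of_lower_end hper hμ r M (by lia)
        have h2 := hh r le_rfl hr
        rw [lowerGain] at h2
        linarith
      · refine le_max_of_le_right ?_
        obtain ⟨y, rfl⟩ : ∃ y, k = y + 1 := ⟨k - 1, by lia⟩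
        have h1 := ih y r (by lia) (by lia) hr (by lia) (fun i hi hi' => hg i hi (by lia)) hh
        have h2 := altSum_succ φ (α - 1) y
        have hM' : (M : ℤ) + r = (u + v + w + 1 : ℕ) + y := by exact_mod_cast (by lia)
        rw [show α + 2 * (r : ℤ) + 2 * M = α - 1 + 2 * y + (2 * (u + v + w + 1 : ℕ) + 1) by
          linarith, hper]
        linarith

/-- Position with Bob to move where exactly `[α + 2a, α + 2b]` has been eaten, with
`p ≤ a ≤ b < q`: Alice follows Bob until he leaves the window `[α + 2p, α + 2(q - 1)]`, and then
takes the piece at the other end. -/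
lemma le_bobVal_of_window
    (hper : ∀ z, φ (z + (2 * (u + v + w + 1 : ℕ) + 1)) = φ z)
    (hμ : ∀ i : ℕ, i ≤ 2 * u + v + w + 1 → μ ≤ altSum φ (α + 1 + 2 * i) (u + v + w + 1 + 1))
    (t : ℝ) (M p a b q : ℕ) (hp : 1 ≤ p) (hpa : p ≤ a) (hab : a ≤ b) (hbq : b < q) (hq : q ≤ u)
    (hM : M + b = u + v + w + 1 + a)
    (hlow : ∀ i, p ≤ i → i ≤ a →
      (∀ y, 1 ≤ y → y ≤ i → t ≤ lowerGain φ α u i - lowerGain φ α u q + upperGain φ α u y) ∧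
      (∀ x, q ≤ x → x ≤ u → t ≤ lowerGain φ α u i - lowerGain φ α u q + lowerGain φ α u x))
    (hupp : ∀ i, b ≤ i → i < q →
      (∀ y, 1 ≤ y → y ≤ p →
        t ≤ upperGain φ α u (i + 1) - upperGain φ α u p + upperGain φ α u y) ∧
      (∀ x, i + 1 ≤ x → x ≤ u →
        t ≤ upperGain φ α u (i + 1) - upperGain φ α u p + lowerGain φ α u x)) :
    μ - altSum φ α (u + 1) + t - (altSum φ α (b + 1) - altSum φ α a) ≤
      bobVal φ (2 * M) (α + 2 * b + 1) := by
  induction M generalizing a b with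
  | zero => lia
  | succ M ih =>
    have hM' : (M : ℤ) + 1 + b = (u + v + w + 1 : ℕ) + a := by exact_mod_cast hM
    rw [bobVal_two_mul_succ]
    refine le_min ?_ ?_
    · rcases (Nat.succ_le_of_lt hbq).eq_or_lt with rfl | hlt
      · refine le_max_of_le_right ?_
        obtain ⟨hy, hx⟩ := hlow a hpa le_rfl
        have h1 := le_bobVal_of_minority hper hμ
          (t - lowerGain φ α u a + lowerGain φ α u (b + 1)) M a (b + 1) (by lia) (by lia) hq
          (by lia) (fun i h h' => by linarith [hy i h h']) (fun i h h' => by linarith [hx i h h'])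
        have h2 := altSum_succ φ (α - 1) a
        rw [show α + 2 * (b : ℤ) + 1 + 2 * M + 1 = α - 1 + 2 * a + (2 * (u + v + w + 1 : ℕ) + 1) by
          linarith, hper]
        rw [show α + 2 * (b + 1 : ℕ) = α + 2 * b + 1 + 1 by push_cast; ring] at h1
        simp only [lowerGain] at h1
        linarith
      · refine le_max_of_le_left ?_
        have h1 := ih a (b + 1) hpa (by lia) hlt (by lia) hlow fun i hi => hupp i (by lia)
        have h2 := altSum_succ φ α (b + 1)
        rw [show α + 2 * (b + 1 : ℕ) = α + 2 * b + 1 + 1 by push_cast; ring] at h1 h2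
        rw [add_assoc (α + 2 * (b : ℤ) + 1), one_add_one_eq_two] at h1
        linarith
    · rcases hpa.eq_or_lt with rfl | hlt
      · refine le_max_of_le_left ?_
        obtain ⟨hy, hx⟩ := hupp b le_rfl hbq
        have h1 := le_bobVal_of_minority hper hμ
          (t - upperGain φ α u (b + 1) + upperGain φ α u p) M p (b + 1) hp (by lia) (by lia)
          (by lia) (fun i h h' => by linarith [hy i h h']) (fun i h h' => by linarith [hx i h h'])
        have h2 := altSum_succ φ (α - 1) (b + 1)
        rw [show α - 1 + 2 * (b + 1 : ℕ) = α + 2 * b + 1 by push_cast; ring] at h2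
        rw [show α + 2 * (b + 1 : ℕ) = α + 2 * b + 1 + 1 by push_cast; ring] at h1
        simp only [upperGain] at h1
        linarith
      · refine le_max_of_le_right ?_
        obtain ⟨y, rfl⟩ : ∃ y, a = y + 1 := ⟨a - 1, by lia⟩
        have h1 := ih y b (by lia) (by lia) hbq (by lia) (fun i hi hi' => hlow i hi (by lia)) hupp
        have h2 := altSum_succ φ α y
        push_cast at hM'
        rw [show α + 2 * (b : ℤ) + 1 + 2 * M = α + 2 * y + (2 * (u + v + w + 1 : ℕ) + 1) by
          push_cast; linarith, hper]
        linarith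

end Interval

/-- Either some index separates the small values of `g` from those of `h`, or there is a window
whose ends are the small values of both functions. -/
lemma exists_threshold_or_window {g h S : ℕ → ℝ} {u : ℕ} {t C D : ℝ} (hu : 1 ≤ u)
    (hgh : ∀ k, D ≤ g k + h k) (hgh' : ∀ k, D ≤ g (k + 1) + h k)
    (hS : Monotone S) (hS₀ : 0 ≤ S 0) (hSC : S u ≤ C)
    (hgS : ∀ x y, x ≤ y → g y - g x ≤ S y - S x)
    (htC : 4 * t ≤ 2 * D - C) (htD : 2 * t ≤ D) (hg : t ≤ g 1) (hh : t ≤ h u) :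
    (∃ i, 1 ≤ i ∧ i ≤ u ∧ (∀ k, 1 ≤ k → k ≤ i → t ≤ g k) ∧ ∀ k, i ≤ k → k ≤ u → t ≤ h k) ∨
    ∃ p j q, 1 ≤ p ∧ p ≤ j ∧ j < q ∧ q ≤ u ∧
      (∀ i, p ≤ i → i ≤ j →
        (∀ y, 1 ≤ y → y ≤ i → t ≤ h i - h q + g y) ∧
        (∀ x, q ≤ x → x ≤ u → t ≤ h i - h q + h x)) ∧
      (∀ i, j ≤ i → i < q →
        (∀ y, 1 ≤ y → y ≤ p → t ≤ g (i + 1) - g p + g y) ∧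
        (∀ x, i + 1 ≤ x → x ≤ u → t ≤ g (i + 1) - g p + h x)) := by
  classical
  by_cases hP : ∃ k, 1 ≤ k ∧ k ≤ u ∧ g k < t
  swap
  · push Not at hP
    exact .inl ⟨u, hu, le_rfl, hP, fun k hk hk' => by rwa [le_antisymm hk' hk]⟩
  obtain ⟨P, ⟨hP1, hPu, hgP⟩, hPmin⟩ : ∃ P, (1 ≤ P ∧ P ≤ u ∧ g P < t) ∧
      ∀ k, 1 ≤ k → k < P → t ≤ g k :=
    ⟨Nat.find hP, Nat.find_spec hP, fun k hk hkP => by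
      have h1 := Nat.find_min hP hkP
      have h2 := (Nat.find_spec hP).2.1
      push Not at h1
      exact h1 hk (by lia)⟩
  obtain ⟨P, rfl⟩ : ∃ x, P = x + 1 := ⟨P - 1, by lia⟩
  have hP0 : 1 ≤ P := by
    by_contra h0
    obtain rfl : P = 0 := by lia
    exact hgP.not_ge hg
  by_cases hr : ∀ k, P ≤ k → k ≤ u → t ≤ h k
  · exact .inl ⟨P, hP0, by lia, fun k hk hk' => hPmin k hk (by lia), hr⟩
  right
  push Not at hr
  obtain ⟨r, hPr, hru, hhr⟩ := hr
  have hrP : P + 1 ≤ r := by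
    by_contra h0
    obtain rfl : r = P := by lia
    linarith [hgh' r]
  obtain ⟨q, hqm, hqmin⟩ := (Finset.Icc (P + 1) u).exists_min_image h ⟨r, by simp [hrP, hru]⟩
  simp only [Finset.mem_Icc, and_imp] at hqm hqmin
  obtain ⟨hPq, hqu⟩ := hqm
  have hη : h q < t := (hqmin r hrP hru).trans_lt hhr
  obtain ⟨p, hpm, hpmin⟩ := (Finset.Icc 1 q).exists_min_image g ⟨P + 1, by simp [hPq]⟩
  simp only [Finset.mem_Icc, and_imp] at hpm hpmin
  obtain ⟨hp1, hpq⟩ := hpm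
  have hγ : g p < t := (hpmin (P + 1) (by lia) hPq).trans_lt hgP
  have hPp : P + 1 ≤ p := by
    by_contra h0
    exact hγ.not_ge (hPmin p hp1 (by lia))
  have hne : p < q := by
    refine hpq.lt_of_ne ?_
    rintro rfl
    linarith [hgh p]
  have build : ∀ j, p ≤ j → j < q →
      (∀ i, p ≤ i → i ≤ j → t ≤ h i ∧ t ≤ h i - h q + g p) →
      (∀ i, j < i → i ≤ q → t ≤ g i ∧ t ≤ g i - g p + h q) →
      ∃ p j q, 1 ≤ p ∧ p ≤ j ∧ j < q ∧ q ≤ u ∧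
        (∀ i, p ≤ i → i ≤ j →
          (∀ y, 1 ≤ y → y ≤ i → t ≤ h i - h q + g y) ∧
          (∀ x, q ≤ x → x ≤ u → t ≤ h i - h q + h x)) ∧
        (∀ i, j ≤ i → i < q →
          (∀ y, 1 ≤ y → y ≤ p → t ≤ g (i + 1) - g p + g y) ∧
          (∀ x, i + 1 ≤ x → x ≤ u → t ≤ g (i + 1) - g p + h x)) := by
    intro j hpj hjq h1 h2
    refine ⟨p, j, q, hp1, hpj, hjq, hqu, fun i hi hi' => ?_, fun i hi hi' => ?_⟩
    · obtain ⟨h3, h4⟩ := h1 i hi hi'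
      exact ⟨fun y hy hy' => by linarith [hpmin y hy (by lia)],
        fun x hx hx' => by linarith [hqmin x (by lia) hx']⟩
    · obtain ⟨h3, h4⟩ := h2 (i + 1) (by lia) (by lia)
      exact ⟨fun y hy hy' => by linarith [hpmin y hy (by lia)],
        fun x hx hx' => by linarith [hqmin x (by lia) hx']⟩
  by_cases hall : ∃ i, p ≤ i ∧ i < q ∧ ¬ (t ≤ h i ∧ t ≤ h i - h q + g p)
  swap
  · push Not at hall
    refine build (q - 1) (by lia) (by lia) (fun i hi hi' => hall i hi (by lia)) fun i hi hi' => ?_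
    obtain rfl : i = q := by lia
    constructor <;> linarith [hgh i]
  obtain ⟨v, ⟨hpv, hvq, hv⟩, hvmin⟩ :
      ∃ v, (p ≤ v ∧ v < q ∧ ¬ (t ≤ h v ∧ t ≤ h v - h q + g p)) ∧
        ∀ i, p ≤ i → i < v → t ≤ h i ∧ t ≤ h i - h q + g p :=
    ⟨Nat.find hall, Nat.find_spec hall, fun i hi hiv => by
      have h1 := Nat.find_min hall hiv
      have h2 := (Nat.find_spec hall).2.1
      by_contra h3
      exact h1 ⟨hi, by lia, h3⟩⟩
  have hpv' : p < v := by
    refine hpv.lt_of_ne ?_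
    rintro rfl
    exact hv ⟨by linarith [hgh p], by linarith [hgh p]⟩
  refine build (v - 1) (by lia) (by lia) (fun i hi hi' => hvmin i hi (by lia)) fun d hd hd' => ?_
  have h1 := hgS p v hpv
  have h2 := hgS d q hd'
  have h3 := hS (show v ≤ d by lia)
  have h4 := hS (Nat.zero_le p)
  have h5 := hS hqu
  have h6 := hgh v
  have h7 := hgh q
  rcases not_and_or.mp hv with h8 | h8 <;> constructor <;> linarith

lemma altSum_mono {φ : ℤ → ℝ} (hφ : ∀ z, 0 ≤ φ z) (a : ℤ) : Monotone (altSum φ a) :=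
  monotone_nat_of_le_succ fun k => by rw [altSum_succ]; linarith [hφ (a + 2 * k)]

/-- Starting inside the interval `[α, α + 2u]`, Alice improves on `μ` minus the interval's
majority pieces by half the minority pieces and a quarter of the majority pieces. -/
lemma exists_start_in_interval {φ : ℤ → ℝ} {α : ℤ} {u v w : ℕ} {μ : ℝ} (hφ : ∀ z, 0 ≤ φ z)
    (hper : ∀ z, φ (z + (2 * (u + v + w + 1 : ℕ) + 1)) = φ z)
    (hμ : ∀ i : ℕ, i ≤ 2 * u + v + w + 1 → μ ≤ altSum φ (α + 1 + 2 * i) (u + v + w + 1 + 1)) :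
    ∃ p, μ - 3 / 4 * altSum φ α (u + 1) + 1 / 2 * altSum φ (α + 1) u ≤
      φ p + bobVal φ (2 * (u + v + w + 1)) (p + 1) := by
  rcases le_or_gt (altSum φ (α + 1) u) (3 / 2 * altSum φ α (u + 1)) with hle | hgt
  · refine ⟨α, ?_⟩
    have h1 := le_bobVal_of_followBob hper μ (u + v + w + 1) (α + 1) fun j hj => hμ j (by lia)
    have h2 := altSum_succ φ (α + 1) (u + v + w + 1)
    rw [add_assoc α, add_comm (1 : ℤ), hper] at h2
    linarith
  have hu : 1 ≤ u := by
    by_contra h0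
    obtain rfl : u = 0 := by lia
    have h1 := altSum_nonneg hφ α (0 + 1)
    rw [altSum_zero] at hgt
    linarith
  have hF := altSum_succ' φ (α - 1) u
  have hF1 := altSum_succ φ (α - 1) 0
  rw [altSum_zero, Nat.cast_zero, mul_zero, add_zero, zero_add] at hF1
  rw [show α - 1 + 2 = α + 1 by ring] at hF
  have hC0 := altSum_nonneg hφ α (u + 1)
  have hfmono := altSum_mono hφ (α - 1)
  have hcmono := altSum_mono hφ α
  obtain ⟨i, hi1, hiu, hg, hh⟩ | ⟨p, j, q, hp, hpj, hjq, hq, hlow, hupp⟩ :=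
    exists_threshold_or_window (g := upperGain φ α u) (h := lowerGain φ α u) (S := altSum φ α)
      (u := u) (t := 1 / 2 * altSum φ (α + 1) u + 1 / 4 * altSum φ α (u + 1))
      (C := altSum φ α (u + 1)) (D := altSum φ (α + 1) u + altSum φ α (u + 1)) hu
      (fun k => by
        simp only [upperGain, lowerGain]
        linarith [hfmono (Nat.le_succ k)])
      (fun k => by
        simp only [upperGain, lowerGain]
        linarith [hcmono (Nat.le_succ k)])
      hcmono (altSum_zero φ α).ge (hcmono (Nat.le_succ u))
      (fun x y hxy => by
        simp only [upperGain]
        linarith [hfmono hxy])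
      (by linarith) (by linarith)
      (by
        simp only [upperGain]
        linarith [altSum_nonneg hφ α 1])
      (by
        simp only [lowerGain]
        linarith [hcmono (Nat.le_succ u)])
  · refine ⟨α - 1 + 2 * i, ?_⟩
    have h1 := le_bobVal_of_minority hper hμ _ _ i i hi1 le_rfl hiu rfl hg hh
    have h2 := altSum_succ φ (α - 1) i
    rw [show α - 1 + 2 * (i : ℤ) + 1 = α + 2 * i by ring]
    linarith
  · refine ⟨α + 2 * j, ?_⟩
    have h1 := le_bobVal_of_window hper hμ _ _ p j j q hp hpj le_rfl hjq hq rfl hlow hupp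
    have h2 := altSum_succ φ α j
    linarith

/-- `α < β < γ` cut a cycle of length `2m + 1` into three arcs of odd length. -/
def IsArcTriple (m : ℕ) (α β γ : ℤ) : Prop :=
  ∃ u v w : ℕ, u + v + w + 1 = m ∧ β = α + 2 * u + 1 ∧ γ = β + 2 * v + 1

lemma exists_isArcTriple {m : ℕ} {P : ℤ → Prop} (hper : ∀ z, P z → P (z + (2 * m + 1)))
    (hex : ∀ z, ∃ j : ℕ, j ≤ m ∧ P (z + 2 * j)) (hadj : ∀ z, P z → ¬ P (z + 1)) :
    ∃ α β γ, IsArcTriple m α β γ ∧ P α ∧ P β ∧ P γ := by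
  classical
  obtain ⟨j, -, hα⟩ := hex 0
  set α : ℤ := 0 + 2 * j
  obtain ⟨x, hx, hmax⟩ := ((Finset.range (m + 1)).filter fun x : ℕ => P (α + 2 * x)).exists_max_image
    id ⟨0, by simpa using hα⟩
  simp only [Finset.mem_filter, Finset.mem_range, id, and_imp] at hx hmax
  obtain ⟨hxm, hPx⟩ := hx
  obtain ⟨i, him, hPi⟩ := hex (α + 2 * x + 1 - 2 * m)
  have hxi : m ≤ x + i := by
    by_contra hlt
    have h1 := hper _ hPi
    rw [show α + 2 * (x : ℤ) + 1 - 2 * m + 2 * i + (2 * m + 1) = α + 2 * (x + i + 1 : ℕ) by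
      push_cast; ring] at h1
    have h2 := hmax (x + i + 1) (by lia) h1
    lia
  obtain ⟨u, hu⟩ := Nat.exists_eq_add_of_le hxi
  have hu' : (x : ℤ) + i = m + u := by exact_mod_cast hu
  rw [show α + 2 * (x : ℤ) + 1 - 2 * m + 2 * i = α + 2 * u + 1 by linarith] at hPi
  have hux : u < x := by
    refine lt_of_le_of_ne (by lia) ?_
    rintro rfl
    exact hadj _ hPx hPi
  obtain ⟨v, rfl⟩ := Nat.exists_eq_add_of_lt hux
  exact ⟨α, α + 2 * u + 1, α + 2 * (u + v + 1 : ℕ), ⟨u, v, m - (u + v + 1), by lia, rfl, by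
    push_cast; ring⟩, hα, hPi, hPx⟩

/-- Moving one point of a minimal triple cannot decrease the value of `H` at that point. -/
lemma min_le_of_isArcTriple_minimal {H : ℤ → ℝ} {L : ℝ} {u v w : ℕ} {α : ℤ}
    (hper : ∀ z, H (z + (2 * (u + v + w + 1 : ℕ) + 1)) = H z)
    (hα : H α < L) (hβ : H (α + 2 * u + 1) < L) (hγ : H (α + 2 * u + 1 + 2 * v + 1) < L)
    (hmin : ∀ α' β' γ', IsArcTriple (u + v + w + 1) α' β' γ' → H α' < L → H β' < L → H γ' < L →
      H α + H (α + 2 * u + 1) + H (α + 2 * u + 1 + 2 * v + 1) ≤ H α' + H β' + H γ')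
    (i : ℕ) (hi : i ≤ 2 * u + v + w + 1) :
    min (H α) (H (α + 2 * u + 1)) ≤ H (α + 1 + 2 * i) := by
  by_contra! hlt
  obtain ⟨h1, h2⟩ := lt_min_iff.mp hlt
  rcases le_or_gt i (u + v) with hle | hgt
  · obtain ⟨x, hx⟩ := Nat.exists_eq_add_of_le hle
    have hx' : (u : ℤ) + v = i + x := by exact_mod_cast hx
    have := hmin α (α + 1 + 2 * i) (α + 2 * u + 1 + 2 * v + 1)
      ⟨i, x, w, by lia, by ring, by linarith⟩ hα (h1.trans hα) hγ
    linarith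
  · obtain ⟨x, rfl⟩ := Nat.exists_eq_add_of_lt hgt
    obtain ⟨y, hy⟩ : ∃ y, u + w = x + y := ⟨u + w - x, by lia⟩
    have hy' : (u : ℤ) + w = x + y := by exact_mod_cast hy
    have h3 := hper (α + 1 + 2 * (u + v + x + 1 : ℕ) - (2 * (u + v + w + 1 : ℕ) + 1))
    rw [sub_add_cancel] at h3
    rw [h3] at h1 h2
    have := hmin _ (α + 2 * u + 1) (α + 2 * u + 1 + 2 * v + 1)
      ⟨y, v, x, by lia, by push_cast; linarith, rfl⟩ (h1.trans hα) hβ hγ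
    linarith

lemma exists_isArcTriple_minimal {m : ℕ} {H : ℤ → ℝ} {L : ℝ}
    (hper : Function.Periodic H (2 * m + 1))
    (hex : ∃ α β γ, IsArcTriple m α β γ ∧ H α < L ∧ H β < L ∧ H γ < L) :
    ∃ α β γ, IsArcTriple m α β γ ∧ H α < L ∧ H β < L ∧ H γ < L ∧
      ∀ α' β' γ', IsArcTriple m α' β' γ' → H α' < L → H β' < L → H γ' < L →
        H α + H β + H γ ≤ H α' + H β' + H γ' := by
  have hfin : (Set.range H).Finite := by
    refine ((Set.finite_Ico (0 : ℤ) (2 * m + 1)).image H).subset ?_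
    rintro _ ⟨z, rfl⟩
    obtain ⟨y, hy, hzy⟩ := hper.exists_mem_Ico₀ (by positivity) z
    exact ⟨y, hy, hzy.symm⟩
  set V : Set ℝ := {x | ∃ α β γ, (IsArcTriple m α β γ ∧ H α < L ∧ H β < L ∧ H γ < L) ∧
    H α + H β + H γ = x}
  have hV : V.Finite := by
    refine (((hfin.prod hfin).prod hfin).image fun x => x.1.1 + x.1.2 + x.2).subset ?_
    rintro _ ⟨α, β, γ, -, rfl⟩
    exact ⟨((H α, H β), H γ), by simp, rfl⟩
  obtain ⟨α, β, γ, h⟩ := hex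
  obtain ⟨_, ⟨α, β, γ, ⟨h1, h2, h3, h4⟩, rfl⟩, hmin⟩ :=
    V.exists_min_image id hV ⟨_, α, β, γ, h, rfl⟩
  exact ⟨α, β, γ, h1, h2, h3, h4, fun α' β' γ' h1 h2 h3 h4 =>
    hmin _ ⟨α', β', γ', ⟨h1, h2, h3, h4⟩, rfl⟩⟩

lemma altSum_eq_add_add (φ : ℤ → ℝ) (α : ℤ) (u v w : ℕ) :
    altSum φ α (u + v + w + 1 + 1) = altSum φ α (u + 1) + altSum φ (α + 2 * u + 1 + 1) v +
      altSum φ (α + 2 * u + 1 + 2 * v + 1) (w + 1) := by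
  rw [show u + v + w + 1 + 1 = u + 1 + v + (w + 1) by ring, altSum_add, altSum_add]
  push_cast
  ring_nf

lemma altSum_add_altSum {φ : ℤ → ℝ} {m : ℕ} (hper : ∀ z, φ (z + (2 * m + 1)) = φ z) (z : ℤ) :
    altSum φ z (m + 1) + altSum φ (z + 1) m = altSum φ 0 (m + 1) + altSum φ 1 m := by
  have hstep : ∀ z, altSum φ (z + 1) (m + 1) + altSum φ (z + 1 + 1) m =
      altSum φ z (m + 1) + altSum φ (z + 1) m := fun z => by
    have h1 := altSum_succ φ (z + 1) m
    have h2 := altSum_succ' φ z m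
    rw [add_assoc z 1, add_comm 1 (2 * (m : ℤ)), hper] at h1
    rw [add_assoc z 1, one_add_one_eq_two]
    linarith
  induction z using Int.induction_on with
  | zero => rw [zero_add]
  | succ i ih => rw [hstep, ih]
  | pred i ih => rw [← ih, ← hstep, sub_add_cancel]

/-- If every starting piece is worth less than `L` to Alice, then so is the improved value of an
interval of a minimal triple. -/
lemma lt_of_isArcTriple_minimal {φ : ℤ → ℝ} {m : ℕ} {L : ℝ} (hφ : ∀ z, 0 ≤ φ z)
    (hper : ∀ z, φ (z + (2 * m + 1)) = φ z) (hlt : ∀ p, φ p + bobVal φ (2 * m) (p + 1) < L)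
    {α β γ : ℤ} {u v w : ℕ} (hm : u + v + w + 1 = m) (hβ : β = α + 2 * u + 1)
    (hγ : γ = β + 2 * v + 1) (hαL : altSum φ α (m + 1) < L) (hβL : altSum φ β (m + 1) < L)
    (hγL : altSum φ γ (m + 1) < L)
    (hmin : ∀ α' β' γ', IsArcTriple m α' β' γ' → altSum φ α' (m + 1) < L →
      altSum φ β' (m + 1) < L → altSum φ γ' (m + 1) < L →
      altSum φ α (m + 1) + altSum φ β (m + 1) + altSum φ γ (m + 1) ≤
        altSum φ α' (m + 1) + altSum φ β' (m + 1) + altSum φ γ' (m + 1)) :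
    min (altSum φ α (m + 1)) (altSum φ β (m + 1)) -
      3 / 4 * altSum φ α (u + 1) + 1 / 2 * altSum φ (α + 1) u < L := by
  subst hm hβ hγ
  obtain ⟨p, hp⟩ := exists_start_in_interval hφ hper
    (min_le_of_isArcTriple_minimal (H := fun z => altSum φ z (u + v + w + 1 + 1))
      (fun z => altSum_periodic hper z _) hαL hβL hγL hmin)
  exact hp.trans_lt (hlt p)

/-- A pizza with an odd number of pieces has a starting piece of value at least `4/9`. -/
lemma exists_start_of_odd {φ : ℤ → ℝ} {m : ℕ} (hφ : ∀ z, 0 ≤ φ z)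
    (hper : ∀ z, φ (z + (2 * m + 1)) = φ z) :
    ∃ p, 4 / 9 * (altSum φ 0 (m + 1) + altSum φ 1 m) ≤ φ p + bobVal φ (2 * m) (p + 1) := by
  by_contra! hlt
  set T := altSum φ 0 (m + 1) + altSum φ 1 m with hT
  have hT0 : 0 ≤ T := add_nonneg (altSum_nonneg hφ _ _) (altSum_nonneg hφ _ _)
  have hHper : ∀ z, altSum φ (z + (2 * m + 1)) (m + 1) = altSum φ z (m + 1) :=
    fun z => altSum_periodic hper z _
  obtain ⟨α, β, γ, ⟨u, v, w, rfl, rfl, rfl⟩, hα, hβ, hγ, hmin⟩ :=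
    exists_isArcTriple_minimal (H := fun z => altSum φ z (m + 1)) (L := 4 / 9 * T) hHper <| by
      refine exists_isArcTriple (m := m) (P := fun z => altSum φ z (m + 1) < 4 / 9 * T)
        (fun z hz => by rwa [hHper]) (fun z => ?_) fun z hz hz' => ?_
      · by_contra! hge
        have h1 := le_bobVal_of_followBob hper _ m z hge
        have h2 := altSum_succ φ z m
        have h3 := hper (z - 1)
        have h4 := hlt (z - 1)
        rw [show z - 1 + (2 * (m : ℤ) + 1) = z + 2 * m by ring] at h3
        rw [sub_add_cancel] at h4
        linarith
      · have h1 := altSum_add_altSum hper z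
        have h2 := altSum_succ φ (z + 1) m
        have h3 := hφ (z + 1 + 2 * m)
        linarith
  set β := α + 2 * (u : ℤ) + 1 with hβ_def
  set γ := β + 2 * (v : ℤ) + 1 with hγ_def
  set N : ℤ := 2 * (u + v + w + 1 : ℕ) + 1 with hN
  have hN' : N = 2 * u + 2 * v + 2 * w + 3 := by rw [hN]; push_cast; ring
  have hγw : γ + 2 * w + 1 = α + N := by lia
  have hγu : γ + 2 * w + 1 + 2 * u + 1 = β + N := by lia
  have gain₁ := lt_of_isArcTriple_minimal hφ hper hlt rfl hβ_def hγ_def hα hβ hγ hmin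
  have gain₂ := lt_of_isArcTriple_minimal hφ hper hlt (α := β) (β := γ) (γ := α + N)
    (show v + w + u + 1 = u + v + w + 1 by ring) hγ_def hγw.symm hβ hγ (by rwa [hHper])
    fun α' β' γ' h h1 h2 h3 => by rw [hHper]; linarith [hmin α' β' γ' h h1 h2 h3]
  have gain₃ := lt_of_isArcTriple_minimal hφ hper hlt (α := γ) (β := α + N) (γ := β + N)
    (show w + u + v + 1 = u + v + w + 1 by ring) hγw.symm (by lia) hγ (by rwa [hHper])
    (by rwa [hHper])
    fun α' β' γ' h h1 h2 h3 => by rw [hHper, hHper]; linarith [hmin α' β' γ' h h1 h2 h3]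
  rw [hHper] at gain₃
  have sum₁ := altSum_eq_add_add φ α u v w
  have sum₂ := altSum_eq_add_add φ β v w u
  have sum₃ := altSum_eq_add_add φ γ w u v
  rw [← hβ_def, ← hγ_def] at sum₁
  rw [show v + w + u + 1 + 1 = u + v + w + 1 + 1 by ring, ← hγ_def, hγw,
    altSum_periodic hper] at sum₂
  rw [show w + u + v + 1 + 1 = u + v + w + 1 + 1 by ring, hγu, hγw, add_right_comm α,
    altSum_periodic hper, altSum_periodic hper] at sum₃
  have total := altSum_add_altSum hper α
  have sum₄ := altSum_add φ (α + 1) u (v + 1)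
  have sum₅ := altSum_add φ (α + 1) (u + (v + 1)) w
  rw [show α + 1 + 2 * (u : ℤ) = β by rw [hβ_def]; ring] at sum₄
  rw [show u + (v + 1) + w = u + v + w + 1 by ring,
    show α + 1 + 2 * ((u + (v + 1) : ℕ) : ℤ) = γ + 1 by push_cast; linarith] at sum₅
  have hc := altSum_nonneg hφ α (u + 1)
  have hf := altSum_nonneg hφ (α + 1) u
  have ha := altSum_nonneg hφ β (v + 1)
  have hd := altSum_nonneg hφ (β + 1) v
  have he := altSum_nonneg hφ γ (w + 1)
  have hb := altSum_nonneg hφ (γ + 1) w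
  clear hlt hmin
  simp only [min_def] at gain₁ gain₂ gain₃
  split_ifs at gain₁ gain₂ gain₃ <;> linarith

lemma altSum_le_bobVal (φ : ℤ → ℝ) (k : ℕ) (a : ℤ) :
    altSum φ (a + 1) k ≤ bobVal φ (2 * k + 1) a := by
  induction k generalizing a with
  | zero => rw [altSum_zero]; exact le_rfl
  | succ k ih =>
    change _ ≤ min (alicePick φ (2 * k + 1) (bobVal φ (2 * k + 1)) (a + 1))
      (alicePick φ (2 * k + 1) (bobVal φ (2 * k + 1)) a)
    refine le_min (le_max_of_le_left ?_) (le_max_of_le_right ?_)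
    · rw [altSum_succ', ← one_add_one_eq_two (R := ℤ), ← add_assoc]
      exact add_le_add_right (ih (a + 1 + 1)) _
    · rw [altSum_succ, show a + ((2 * k + 1 : ℕ) : ℤ) = a + 1 + 2 * k by push_cast; ring, add_comm]
      exact add_le_add_right (ih a) _

/-- A pizza with an even number of pieces has a starting piece of value at least one half. -/
lemma exists_start_of_even (φ : ℤ → ℝ) (k : ℕ) :
    ∃ p, 1 / 2 * (altSum φ 0 (k + 1) + altSum φ 1 (k + 1)) ≤ φ p + bobVal φ (2 * k + 1) (p + 1) := by
  have key : ∀ p, altSum φ p (k + 1) ≤ φ p + bobVal φ (2 * k + 1) (p + 1) := fun p => by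
    have h1 := altSum_le_bobVal φ k (p + 1)
    rw [add_assoc, one_add_one_eq_two] at h1
    linarith [altSum_succ' φ p k]
  by_contra! hlt
  have h0 := (key 0).trans_lt (hlt 0)
  have h1 := (key 1).trans_lt (hlt 1)
  linarith

lemma sum_range_two_mul_eq_altSum (φ : ℤ → ℝ) (k : ℕ) :
    ∑ i ∈ Finset.range (2 * k), φ i = altSum φ 0 k + altSum φ 1 k := by
  induction k with
  | zero => simp [altSum]
  | succ k ih =>
    rw [show 2 * (k + 1) = 2 * k + 1 + 1 by ring, Finset.sum_range_succ, Finset.sum_range_succ, ih,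
      altSum_succ, altSum_succ]
    push_cast
    ring_nf

lemma sum_zmod_eq_sum_range {n : ℕ} [NeZero n] (s : ZMod n → ℝ) :
    ∑ i, s i = ∑ i ∈ Finset.range n, s ((i : ℤ) : ZMod n) := by
  obtain ⟨k, rfl⟩ := Nat.exists_eq_succ_of_ne_zero (NeZero.ne n)
  rw [← Fin.sum_univ_eq_sum_range fun i => s ((i : ℤ) : ZMod (k + 1))]
  refine Finset.sum_congr rfl fun i _ => ?_
  rw [Int.cast_natCast]
  exact congrArg s (ZMod.natCast_zmod_val (n := k + 1) i).symm

/-- Every pizza has a starting piece of value at least `4/9`. -/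
lemma exists_start {n : ℕ} [NeZero n] (s : ZMod n → ℝ) (hs : ∀ i, 0 ≤ s i) :
    ∃ p : ℤ, (4 / 9) * (∑ i, s i) ≤
      s (p : ZMod n) + bobVal (fun z : ℤ => s z) (n - 1) (p + 1) := by
  have hs0 : 0 ≤ ∑ i, s i := Finset.sum_nonneg fun i _ => hs i
  rw [sum_zmod_eq_sum_range] at hs0 ⊢
  rcases Nat.even_or_odd n with he | ⟨m, rfl⟩
  · obtain ⟨k, rfl⟩ : ∃ k, n = 2 * (k + 1) :=
      ⟨n / 2 - 1, by have := NeZero.pos n; obtain ⟨x, hx⟩ := he; lia⟩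
    rw [sum_range_two_mul_eq_altSum fun z : ℤ => s z] at hs0 ⊢
    obtain ⟨p, hp⟩ := exists_start_of_even (fun z : ℤ => s z) k
    exact ⟨p, le_trans (by linarith) hp⟩
  · obtain ⟨p, hp⟩ := exists_start_of_odd (φ := fun z : ℤ => s z) (m := m) (fun z => hs z)
      fun z => congrArg s (by
        have := ZMod.natCast_self (2 * m + 1)
        push_cast at this ⊢
        rw [this, add_zero])
    refine ⟨p, le_trans (le_of_eq ?_) hp⟩
    rw [Finset.sum_range_succ, sum_range_two_mul_eq_altSum fun z : ℤ => s z, altSum_succ]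
    push_cast
    ring_nf

/-- Alice has a strategy guaranteeing her at least 4/9 of the total size of any
pizza, and the constant 4/9 is optimal: there is a pizza on which Bob can
prevent Alice from exceeding 4/9 of the total size. -/
theorem stmt4 :
    (∀ (n : ℕ) [NeZero n] (s : ZMod n → ℝ), (∀ i, 0 ≤ s i) →
      ∃ (p : ZMod n) (σ : List Bool → Bool), ∀ τ : List Bool → Bool,
        (4 / 9) * (∑ i, s i) ≤ aliceOutcome n s p σ τ) ∧
    (∃ (n : ℕ) (s : ZMod (n + 1) → ℝ), (∀ i, 0 ≤ s i) ∧
      ∃ τ : ZMod (n + 1) → List Bool → Bool, ∀ (p : ZMod (n + 1)) (σ : List Bool → Bool),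
        aliceOutcome (n + 1) s p σ (τ p) ≤ (4 / 9) * ∑ i, s i) := by
  refine ⟨fun n _ s hs => ?_, exists_pizza_le_four_ninths⟩
  obtain ⟨p, hp⟩ := exists_start s hs
  obtain ⟨σ, hσ⟩ := exists_strategy_alice s p
  exact ⟨p, σ, fun τ => hp.trans (hσ τ)⟩
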